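/- Fix an integer d ≥ 2 and an integer k ≥ 1. The function G_k is strictly monotonically decreasing on (0,∞), satisfies G_k(z) > 1 for every z > 0, and has the limits G_k(z) → ∞ as z → 0⁺ and G_k(z) → 1 as z → ∞. In particular, G_k maps (0,∞) bijectively onto (1,∞). -/

import Mathlib

open MeasureTheory Real Filter

/-- The modified Bessel function of the second kind, defined via its integral
representation `K_ν(z) = ∫_0^∞ exp(−z cosh t) cosh(ν t) dt`. -/
noncomputable def besselK (ν z : ℝ) : ℝ :=
  ∫ t in Set.Ioi (0:ℝ), Real.exp (-z * Real.cosh t) * Real.cosh (ν * t)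

/-- The ratio `G_k(z) = K_{(d+1)/2+k}(z) / K_{(d+1)/2}(z)`. -/
noncomputable def G (d k : ℤ) (z : ℝ) : ℝ :=
  besselK (((d : ℝ) + 1) / 2 + (k : ℝ)) z / besselK (((d : ℝ) + 1) / 2) z

theorem exp_neg_mul_cosh_mul_cosh_le (ν : ℝ) {z t : ℝ} (hz : 0 < z) (ht : 0 ≤ t) :
    Real.exp (-z * Real.cosh t) * Real.cosh (ν * t) ≤
      Real.exp ((|ν| + 1) ^ 2 / z) * Real.exp (-t) := by
  have hcosh : Real.cosh (ν * t) ≤ Real.exp (|ν| * t) := by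
    rw [← Real.cosh_abs, abs_mul, abs_of_nonneg ht, Real.cosh_eq]
    have : Real.exp (-(|ν| * t)) ≤ Real.exp (|ν| * t) := by
      gcongr
      have : 0 ≤ |ν| * t := by positivity
      linarith
    linarith
  have hquad : t ^ 2 / 4 ≤ Real.cosh t := by
    have := Real.quadratic_le_exp_of_nonneg ht
    have := Real.exp_pos (-t)
    rw [Real.cosh_eq]
    linarith
  have hexp : -z * Real.cosh t + |ν| * t ≤ (|ν| + 1) ^ 2 / z + -t := by
    have h : 0 ≤ ((|ν| + 1) - z * t / 2) ^ 2 / z := by positivity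
    have e : ((|ν| + 1) - z * t / 2) ^ 2 / z =
        (|ν| + 1) ^ 2 / z - (|ν| + 1) * t + z * (t ^ 2 / 4) := by
      field_simp
      ring
    have := mul_le_mul_of_nonneg_left hquad hz.le
    linarith
  calc Real.exp (-z * Real.cosh t) * Real.cosh (ν * t)
      ≤ Real.exp (-z * Real.cosh t) * Real.exp (|ν| * t) := by gcongr
    _ ≤ _ := by
      rw [← Real.exp_add, ← Real.exp_add]
      gcongr

theorem integrableOn_besselK (ν : ℝ) {z : ℝ} (hz : 0 < z) :
    IntegrableOn (fun t => Real.exp (-z * Real.cosh t) * Real.cosh (ν * t)) (Set.Ioi 0) := by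
  refine Integrable.mono' ((integrableOn_exp_neg_Ioi 0).const_mul (Real.exp ((|ν| + 1) ^ 2 / z)))
    (by fun_prop) ?_
  filter_upwards [ae_restrict_mem measurableSet_Ioi] with t ht
  rw [Real.norm_of_nonneg (by positivity)]
  exact exp_neg_mul_cosh_mul_cosh_le ν hz (le_of_lt ht)

theorem setIntegral_Ioi_pos {f : ℝ → ℝ} {a : ℝ} (ha : 0 ≤ a)
    (hf : IntegrableOn f (Set.Ioi 0)) (h0 : ∀ t, 0 < t → 0 ≤ f t) (h1 : ∀ t, a < t → 0 < f t) :
    0 < ∫ t in Set.Ioi (0 : ℝ), f t := by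
  rw [setIntegral_pos_iff_support_of_nonneg_ae _ hf]
  · refine lt_of_lt_of_le ?_ (measure_mono (s := Set.Ioi a) fun t ht =>
      ⟨(h1 t ht).ne', lt_of_le_of_lt ha ht⟩)
    simp
  · filter_upwards [ae_restrict_mem measurableSet_Ioi] with t ht using h0 t ht

theorem besselK_pos (ν : ℝ) {z : ℝ} (hz : 0 < z) : 0 < besselK ν z :=
  setIntegral_Ioi_pos le_rfl (integrableOn_besselK ν hz) (fun _ _ => by positivity)
    fun _ _ => by positivity

theorem besselK_le_besselK {μ ν z : ℝ} (hz : 0 < z) (h : |μ| ≤ |ν|) :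
    besselK μ z ≤ besselK ν z := by
  refine setIntegral_mono_on (integrableOn_besselK μ hz) (integrableOn_besselK ν hz)
    measurableSet_Ioi fun t _ => ?_
  gcongr
  rw [Real.cosh_le_cosh, abs_mul, abs_mul]
  gcongr

theorem besselK_lt_besselK {μ ν z : ℝ} (hz : 0 < z) (h : |μ| < |ν|) :
    besselK μ z < besselK ν z := by
  rw [← sub_pos, besselK, besselK,
    ← integral_sub (integrableOn_besselK ν hz) (integrableOn_besselK μ hz)]
  have key : ∀ t, 0 < t → 0 < Real.exp (-z * Real.cosh t) * Real.cosh (ν * t) -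
      Real.exp (-z * Real.cosh t) * Real.cosh (μ * t) := fun t ht => by
    rw [sub_pos]
    gcongr
    rw [Real.cosh_lt_cosh, abs_mul, abs_mul, abs_of_pos ht]
    gcongr
  exact setIntegral_Ioi_pos le_rfl
    ((integrableOn_besselK ν hz).sub (integrableOn_besselK μ hz)) (fun t ht => (key t ht).le) key

theorem besselK_add_one (ν : ℝ) {z : ℝ} (hz : 0 < z) :
    besselK (ν + 1) z = besselK (ν - 1) z + 2 * ν / z * besselK ν z := by
  have hderiv (t : ℝ) : HasDerivAt (fun t => Real.exp (-z * Real.cosh t) * Real.sinh (ν * t))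
      (ν * (Real.exp (-z * Real.cosh t) * Real.cosh (ν * t)) -
        z / 2 * (Real.exp (-z * Real.cosh t) * Real.cosh ((ν + 1) * t) -
          Real.exp (-z * Real.cosh t) * Real.cosh ((ν - 1) * t))) t := by
    have h1 := ((Real.hasDerivAt_cosh t).const_mul (-z)).exp
    have h2 := ((hasDerivAt_id t).const_mul ν).sinh
    refine (h1.mul h2).congr_deriv ?_
    rw [add_mul, sub_mul, one_mul, Real.cosh_add, Real.cosh_sub]
    simp only [id]
    ring
  have hlim : Tendsto (fun t => Real.exp (-z * Real.cosh t) * Real.sinh (ν * t)) atTop (nhds 0) := by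
    have h := (Real.tendsto_exp_neg_atTop_nhds_zero).const_mul (Real.exp ((|ν| + 1) ^ 2 / z))
    rw [mul_zero] at h
    refine squeeze_zero_norm' ?_ h
    filter_upwards [eventually_ge_atTop 0] with t ht
    refine le_trans ?_ (exp_neg_mul_cosh_mul_cosh_le ν hz ht)
    rw [norm_mul, Real.norm_of_nonneg (Real.exp_pos _).le, Real.norm_eq_abs]
    gcongr
    refine abs_le_of_sq_le_sq ?_ (Real.cosh_pos _).le
    rw [Real.sinh_sq]
    linarith
  have i0 := (integrableOn_besselK ν hz).const_mul ν
  have ip := integrableOn_besselK (ν + 1) hz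
  have im := integrableOn_besselK (ν - 1) hz
  have ipm : IntegrableOn (fun t => z / 2 * (Real.exp (-z * Real.cosh t) * Real.cosh ((ν + 1) * t) -
      Real.exp (-z * Real.cosh t) * Real.cosh ((ν - 1) * t))) (Set.Ioi 0) :=
    (ip.sub im).const_mul (z / 2)
  have h := integral_Ioi_of_hasDerivAt_of_tendsto' (a := 0) (fun t _ => hderiv t)
    (i0.sub ipm) hlim
  rw [integral_sub i0 ipm, integral_const_mul, integral_const_mul,
    integral_sub ip im] at h
  simp only [mul_zero, Real.sinh_zero, sub_zero] at h
  change ν * besselK ν z - z / 2 * (besselK (ν + 1) z - besselK (ν - 1) z) = 0 at h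
  field_simp
  linarith

theorem continuousOn_besselK (ν : ℝ) : ContinuousOn (besselK ν) (Set.Ioi 0) := by
  intro z hz
  have hz : 0 < z := hz
  refine ContinuousAt.continuousWithinAt ?_
  refine continuousAt_of_dominated (Eventually.of_forall fun x => by fun_prop) ?_
    (integrableOn_besselK ν (half_pos hz)) (Eventually.of_forall fun t => by fun_prop)
  filter_upwards [eventually_gt_nhds (half_lt_self hz)] with x hx
  refine Eventually.of_forall fun t => ?_
  rw [Real.norm_of_nonneg (by positivity)]
  have := Real.cosh_pos t
  gcongr

theorem cosh_mul_cosh_lt {μ ν s t : ℝ} (hμ : 0 < μ) (hν : μ < ν) (ht : 0 ≤ t) (hst : t < s) :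
    Real.cosh (ν * t) * Real.cosh (μ * s) < Real.cosh (ν * s) * Real.cosh (μ * t) := by
  have h1 : Real.cosh (ν * t + μ * s) < Real.cosh (ν * s + μ * t) := by
    rw [Real.cosh_lt_cosh, abs_of_nonneg (by nlinarith), abs_of_nonneg (by nlinarith)]
    nlinarith
  have h2 : Real.cosh (ν * t - μ * s) < Real.cosh (ν * s - μ * t) := by
    rw [Real.cosh_lt_cosh]
    refine lt_of_lt_of_le (abs_lt.2 ⟨?_, ?_⟩) (le_abs_self _) <;> nlinarith
  rw [Real.cosh_add, Real.cosh_add] at h1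
  rw [Real.cosh_sub, Real.cosh_sub] at h2
  linarith

theorem strictAntiOn_besselK_div {μ ν : ℝ} (hμ : 0 < μ) (hν : μ < ν) :
    StrictAntiOn (fun z => besselK ν z / besselK μ z) (Set.Ioi 0) := by
  intro z hz w hw hzw
  have hz : 0 < z := hz
  have hw : 0 < w := hw
  have hc : 1 < besselK ν z / besselK μ z := by
    rw [one_lt_div (besselK_pos μ hz)]
    exact besselK_lt_besselK hz (by rwa [abs_of_pos hμ, abs_of_pos (hμ.trans hν)])
  have hcz : besselK ν z = besselK ν z / besselK μ z * besselK μ z :=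
    (div_mul_cancel₀ _ (besselK_pos μ hz).ne').symm
  change besselK ν w / besselK μ w < besselK ν z / besselK μ z
  generalize besselK ν z / besselK μ z = c at hc hcz ⊢
  have hint {x : ℝ} (hx : 0 < x) : IntegrableOn (fun t =>
      Real.exp (-x * Real.cosh t) * Real.cosh (ν * t) -
        c * (Real.exp (-x * Real.cosh t) * Real.cosh (μ * t))) (Set.Ioi 0) :=
    (integrableOn_besselK ν hx).sub ((integrableOn_besselK μ hx).const_mul c)
  have hval {x : ℝ} (hx : 0 < x) : ∫ t in Set.Ioi (0 : ℝ),
      (Real.exp (-x * Real.cosh t) * Real.cosh (ν * t) -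
        c * (Real.exp (-x * Real.cosh t) * Real.cosh (μ * t))) =
      besselK ν x - c * besselK μ x := by
    rw [integral_sub (integrableOn_besselK ν hx) ((integrableOn_besselK μ hx).const_mul c),
      integral_const_mul]
    rfl
  obtain ⟨b, hb, hφb⟩ : ∃ b, 0 < b ∧ 0 ≤ Real.cosh (ν * b) - c * Real.cosh (μ * b) := by
    by_contra! hneg
    have hpos (t : ℝ) (ht : 0 < t) :
        0 < -(Real.exp (-z * Real.cosh t) * Real.cosh (ν * t) -
          c * (Real.exp (-z * Real.cosh t) * Real.cosh (μ * t))) := by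
      have := mul_pos (Real.exp_pos (-z * Real.cosh t)) (neg_pos.2 (hneg t ht))
      linarith
    have := setIntegral_Ioi_pos le_rfl (hint hz).neg (fun t ht => (hpos t ht).le) hpos
    simp only [Pi.neg_apply] at this
    rw [integral_neg, hval hz] at this
    linarith
  obtain ⟨a, ⟨ha, -⟩, hφa⟩ : (0 : ℝ) ∈
      (fun t => Real.cosh (ν * t) - c * Real.cosh (μ * t)) '' Set.Icc 0 b :=
    intermediate_value_Icc hb.le (by fun_prop) ⟨by simpa using hc.le, hφb⟩
  have hφa : Real.cosh (ν * a) = c * Real.cosh (μ * a) := sub_eq_zero.1 hφa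
  have hlt (t : ℝ) (ht : 0 < t) (hta : t < a) : Real.cosh (ν * t) - c * Real.cosh (μ * t) < 0 := by
    have h := cosh_mul_cosh_lt hμ hν ht.le hta
    rw [hφa] at h
    exact sub_neg.2 (lt_of_mul_lt_mul_right (by linarith) (Real.cosh_pos (μ * a)).le)
  have hgt (t : ℝ) (hta : a < t) : 0 < Real.cosh (ν * t) - c * Real.cosh (μ * t) := by
    have h := cosh_mul_cosh_lt hμ hν ha hta
    rw [hφa] at h
    exact sub_pos.2 (lt_of_mul_lt_mul_right (by linarith) (Real.cosh_pos (μ * a)).le)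
  set r := Real.exp (-(w - z) * Real.cosh a) with hr
  have hfac (t : ℝ) :
      r * (Real.exp (-z * Real.cosh t) * Real.cosh (ν * t) -
          c * (Real.exp (-z * Real.cosh t) * Real.cosh (μ * t))) -
        (Real.exp (-w * Real.cosh t) * Real.cosh (ν * t) -
          c * (Real.exp (-w * Real.cosh t) * Real.cosh (μ * t))) =
      Real.exp (-z * Real.cosh t) * ((r - Real.exp (-(w - z) * Real.cosh t)) *
        (Real.cosh (ν * t) - c * Real.cosh (μ * t))) := by
    have : Real.exp (-w * Real.cosh t) =
        Real.exp (-z * Real.cosh t) * Real.exp (-(w - z) * Real.cosh t) := by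
      rw [← Real.exp_add]
      ring_nf
    rw [this]
    ring
  have hpos (t : ℝ) (hta : a < t) : 0 < Real.exp (-z * Real.cosh t) *
      ((r - Real.exp (-(w - z) * Real.cosh t)) *
        (Real.cosh (ν * t) - c * Real.cosh (μ * t))) := by
    refine mul_pos (Real.exp_pos _) (mul_pos ?_ (hgt t hta))
    have : Real.cosh a < Real.cosh t := by
      rwa [Real.cosh_lt_cosh, abs_of_nonneg ha, abs_of_pos (ha.trans_lt hta)]
    rw [hr, sub_pos, Real.exp_lt_exp]
    nlinarith
  have hnonneg (t : ℝ) (ht : 0 < t) : 0 ≤ Real.exp (-z * Real.cosh t) *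
      ((r - Real.exp (-(w - z) * Real.cosh t)) *
        (Real.cosh (ν * t) - c * Real.cosh (μ * t))) := by
    rcases lt_trichotomy t a with hta | rfl | hta
    · refine mul_nonneg (Real.exp_pos _).le (mul_nonneg_of_nonpos_of_nonpos ?_ (hlt t ht hta).le)
      have : Real.cosh t < Real.cosh a := by
        rwa [Real.cosh_lt_cosh, abs_of_nonneg ha, abs_of_pos ht]
      rw [hr, sub_nonpos, Real.exp_le_exp]
      nlinarith
    · simp [hr]
    · exact (hpos t hta).le
  have hI := setIntegral_Ioi_pos ha (((hint hz).const_mul r).sub (hint hw))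
    (fun t ht => (hnonneg t ht).trans_eq (hfac t).symm)
    (fun t ht => (hpos t ht).trans_eq (hfac t).symm)
  simp only [Pi.sub_apply] at hI
  rw [integral_sub ((hint hz).const_mul r) (hint hw), integral_const_mul, hval hz, hval hw,
    ← hcz, sub_self, mul_zero] at hI
  rw [div_lt_iff₀ (besselK_pos μ hw)]
  linarith

theorem tendsto_besselK_add_one_div {ν : ℝ} (hν : 1 / 2 ≤ ν) :
    Tendsto (fun z => besselK (ν + 1) z / besselK ν z) atTop (nhds 1) := by
  have h : Tendsto (fun z : ℝ => 1 + 2 * ν / z) atTop (nhds 1) := by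
    simpa using (tendsto_const_nhds (x := 2 * ν)).div_atTop tendsto_id |>.const_add 1
  refine tendsto_of_tendsto_of_tendsto_of_le_of_le' tendsto_const_nhds h ?_ ?_
  · filter_upwards [eventually_gt_atTop 0] with z hz
    rw [one_le_div (besselK_pos ν hz)]
    refine besselK_le_besselK hz ?_
    rw [abs_of_nonneg (by linarith), abs_of_nonneg (by linarith)]
    linarith
  · filter_upwards [eventually_gt_atTop 0] with z hz
    have : besselK (ν - 1) z ≤ besselK ν z :=
      besselK_le_besselK hz (by
        rw [abs_of_nonneg (a := ν) (by linarith), abs_le]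
        constructor <;> linarith)
    rw [div_le_iff₀ (besselK_pos ν hz), besselK_add_one ν hz]
    linarith

theorem tendsto_besselK_add_natCast_div {ν : ℝ} (hν : 1 / 2 ≤ ν) (n : ℕ) :
    Tendsto (fun z => besselK (ν + n) z / besselK ν z) atTop (nhds 1) := by
  induction n with
  | zero =>
    refine tendsto_const_nhds.congr' ?_
    filter_upwards [eventually_gt_atTop 0] with z hz
    simp [(besselK_pos ν hz).ne']
  | succ n ih =>
    have hn : (0 : ℝ) ≤ n := n.cast_nonneg
    have h := (tendsto_besselK_add_one_div (ν := ν + n) (by linarith)).mul ih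
    rw [one_mul] at h
    refine h.congr' ?_
    filter_upwards [eventually_gt_atTop 0] with z hz
    rw [div_mul_div_cancel₀ (besselK_pos _ hz).ne']
    push_cast
    rw [add_assoc]

theorem tendsto_besselK_div_nhdsGT_zero {μ ν : ℝ} (hμ : 0 < μ) (hν : μ + 1 ≤ ν) :
    Tendsto (fun z => besselK ν z / besselK μ z) (nhdsWithin 0 (Set.Ioi 0)) atTop := by
  refine tendsto_atTop_mono' _ ?_ (tendsto_inv_nhdsGT_zero.const_mul_atTop
    (show 0 < 2 * μ by linarith))
  filter_upwards [self_mem_nhdsWithin] with z hz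
  have hz : 0 < z := hz
  rw [le_div_iff₀ (besselK_pos μ hz), ← div_eq_mul_inv]
  have h1 : besselK (μ + 1) z ≤ besselK ν z := besselK_le_besselK hz (by
    rw [abs_of_nonneg (by linarith), abs_of_nonneg (by linarith)]
    exact hν)
  have h2 := besselK_add_one μ hz
  have h3 := besselK_pos (μ - 1) hz
  linarith

/-- For every integer `k ≥ 1`, `G_k` is strictly monotonically decreasing on `(0,∞)`,
satisfies `G_k(z) > 1`, tends to `∞` as `z → 0⁺` and to `1` as `z → ∞`, and maps
`(0,∞)` bijectively onto `(1,∞)`. -/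
theorem G_k_strictAnti (d : ℤ) (hd : 2 ≤ d) (k : ℤ) (hk : 1 ≤ k) :
    StrictAntiOn (G d k) (Set.Ioi 0) ∧
    (∀ z : ℝ, 0 < z → 1 < G d k z) ∧
    Tendsto (G d k) (nhdsWithin 0 (Set.Ioi 0)) atTop ∧
    Tendsto (G d k) atTop (nhds 1) ∧
    Set.BijOn (G d k) (Set.Ioi 0) (Set.Ioi 1) := by
  have hd' : (2 : ℝ) ≤ d := by exact_mod_cast hd
  have hk' : (1 : ℝ) ≤ k := by exact_mod_cast hk
  have hanti : StrictAntiOn (G d k) (Set.Ioi 0) :=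
    strictAntiOn_besselK_div (by linarith) (by linarith)
  have hgt : ∀ z : ℝ, 0 < z → 1 < G d k z := fun z hz => by
    rw [G, one_lt_div (besselK_pos _ hz)]
    refine besselK_lt_besselK hz ?_
    rw [abs_of_nonneg (by linarith), abs_of_nonneg (by linarith)]
    linarith
  have hzero : Tendsto (G d k) (nhdsWithin 0 (Set.Ioi 0)) atTop :=
    tendsto_besselK_div_nhdsGT_zero (by linarith) (by linarith)
  have hinf : Tendsto (G d k) atTop (nhds 1) := by
    have h := tendsto_besselK_add_natCast_div (ν := ((d : ℝ) + 1) / 2) (by linarith) k.toNat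
    have hcast : ((k.toNat : ℕ) : ℝ) = (k : ℝ) := by
      exact_mod_cast Int.toNat_of_nonneg (by lia : 0 ≤ k)
    rwa [hcast] at h
  have hcont : ContinuousOn (G d k) (Set.Ioi 0) :=
    (continuousOn_besselK _).div (continuousOn_besselK _) fun z hz => (besselK_pos _ hz).ne'
  refine ⟨hanti, hgt, hzero, hinf, hgt, hanti.injOn, fun y hy => ?_⟩
  obtain ⟨a, hya, ha⟩ := ((hzero.eventually_ge_atTop y).and self_mem_nhdsWithin).exists
  obtain ⟨b, hyb, hb⟩ := ((hinf.eventually_lt_const hy).and (eventually_gt_atTop 0)).exists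
  exact isPreconnected_Ioi.intermediate_value hb ha hcont ⟨hyb.le, hya⟩
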